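/- Let (c_n)_{n≥1} be a regular sequence with subexponential growth and define γ_n := c_{2^{n+1}} / (6·c_{2^n}²) for n ≥ 1. Then for every integer s ≥ 0, the series Σ_{k=s+1}^{∞} 2^{s−k}·log γ_k converges and √(1 − 2γ_{s+1}) / (2·exp(Σ_{k=s+1}^{∞} 2^{s−k}·log γ_k)) ≥ √6 · c_{2^{s+1}}. -/

import Mathlib

open Filter

/-- A sequence `(s n)` (indexed from 1) is a regular sequence with subexponential
growth if: (i) `s n ≥ e` for all `n ≥ 1`, (ii) `(s n)` is monotone increasing, and
(iii) `((log s n)/n)` is monotone decreasing with limit `0`. -/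
def IsRegularSubexp (s : ℕ → ℝ) : Prop :=
  (∀ n, 1 ≤ n → Real.exp 1 ≤ s n) ∧
  (∀ n m, 1 ≤ n → n ≤ m → s n ≤ s m) ∧
  (∀ n, 1 ≤ n → Real.log (s (n + 1)) / (n + 1) ≤ Real.log (s n) / n) ∧
  Filter.Tendsto (fun n => Real.log (s n) / n) Filter.atTop (nhds 0)

/-- Dyadic consequence of the monotonicity of `log (c n) / n`. -/
theorem IsRegularSubexp.log_two_pow_succ_le {c : ℕ → ℝ} (hc : IsRegularSubexp c) (n : ℕ) :
    Real.log (c (2 ^ (n + 1))) ≤ 2 * Real.log (c (2 ^ n)) := by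
  have hanti : ∀ m, 2 ^ n ≤ m →
      Real.log (c m) / m ≤ Real.log (c (2 ^ n)) / ((2 ^ n : ℕ) : ℝ) := by
    intro m hm
    induction m, hm using Nat.le_induction with
    | base => exact le_rfl
    | succ m hm ih =>
      push_cast at ih ⊢
      exact (hc.2.2.1 m (Nat.one_le_two_pow.trans hm)).trans ih
  have h := hanti (2 ^ (n + 1)) (Nat.pow_le_pow_right two_pos n.le_succ)
  push_cast at h
  rw [div_le_div_iff₀ (by positivity) (by positivity), pow_succ (2 : ℝ)] at h
  have hpos : (0 : ℝ) < 2 ^ n := by positivity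
  nlinarith

/-- The increments of an antitone sequence tending to `0` telescope. -/
theorem hasSum_succ_sub_of_antitone {b : ℕ → ℝ} (hb : Antitone b)
    (hlim : Tendsto b atTop (nhds 0)) : HasSum (fun j => b (j + 1) - b j) (-b 0) := by
  have h : HasSum (fun j => b j - b (j + 1)) (b 0) := by
    rw [hasSum_iff_tendsto_nat_of_nonneg fun j => sub_nonneg.2 (hb j.le_succ)]
    simp only [Finset.sum_range_sub']
    simpa using hlim.const_sub (b 0)
  simpa using h.neg

/-- If `(c n)` is a regular sequence with subexponential growth and
`γ n := c (2^(n+1)) / (6 · c (2^n)²)`, then for every `s ≥ 0` the series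
`∑_{k=s+1}^{∞} 2^(s-k) · log γ k` (reindexed by `k = s + 1 + j`) converges, with sum
`L` say, and `√(1 - 2 γ (s+1)) / (2 exp L) ≥ √6 · c (2^(s+1))`. -/
theorem stmt13 (c : ℕ → ℝ) (hreg : IsRegularSubexp c)
    (γ : ℕ → ℝ)
    (hγ : ∀ n, 1 ≤ n → γ n = c (2 ^ (n + 1)) / (6 * (c (2 ^ n)) ^ 2)) :
    ∀ s : ℕ, ∃ L : ℝ,
      HasSum (fun j : ℕ => (2 : ℝ) ^ (-((j : ℝ) + 1)) * Real.log (γ (s + 1 + j))) L ∧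
      Real.sqrt 6 * c (2 ^ (s + 1)) ≤
        Real.sqrt (1 - 2 * γ (s + 1)) / (2 * Real.exp L) := by
  intro s
  have hpos : ∀ n, 0 < c (2 ^ n) := fun n =>
    (Real.exp_pos 1).trans_le (hreg.1 _ Nat.one_le_two_pow)
  have hlogγ : ∀ k, 1 ≤ k → Real.log (γ k) =
      Real.log (c (2 ^ (k + 1))) - 2 * Real.log (c (2 ^ k)) - Real.log 6 := by
    intro k hk
    rw [hγ k hk, Real.log_div (hpos _).ne' (by have := hpos k; positivity),
      Real.log_mul (by norm_num) (pow_ne_zero 2 (hpos k).ne'), Real.log_pow]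
    push_cast
    ring
  let b : ℕ → ℝ := fun j => Real.log (c (2 ^ (s + 1 + j))) / 2 ^ j
  have hb : Antitone b := by
    refine antitone_nat_of_succ_le fun j => ?_
    have h := hreg.log_two_pow_succ_le (s + 1 + j)
    change Real.log (c (2 ^ (s + 1 + j + 1))) / 2 ^ (j + 1) ≤
      Real.log (c (2 ^ (s + 1 + j))) / 2 ^ j
    rw [pow_succ (2 : ℝ) j, ← div_div, div_right_comm]
    gcongr
    linarith
  have hlim : Tendsto b atTop (nhds 0) := by
    have hsub : Tendsto (fun j : ℕ => 2 ^ (s + 1 + j)) atTop (atTop : Filter ℕ) :=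
      (tendsto_pow_atTop_atTop_of_one_lt one_lt_two).comp
        (tendsto_atTop_mono (fun j => Nat.le_add_left j (s + 1)) tendsto_id)
    have h := (hreg.2.2.2.comp hsub).const_mul ((2 : ℝ) ^ (s + 1))
    rw [mul_zero] at h
    refine h.congr fun j => ?_
    simp only [Function.comp_apply, b]
    push_cast
    rw [pow_add (2 : ℝ) (s + 1) j]
    field_simp
  have hgeom : HasSum (fun j : ℕ => (1 / 2 : ℝ) ^ j * (Real.log 6 / 2)) (Real.log 6) := by
    have h := hasSum_geometric_two.mul_right (Real.log 6 / 2)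
    rwa [mul_div_cancel₀ _ two_ne_zero] at h
  refine ⟨-b 0 - Real.log 6, ?_, ?_⟩
  · refine (congrArg (HasSum · _) (funext fun j => ?_)).mpr
      ((hasSum_succ_sub_of_antitone hb hlim).sub hgeom)
    rw [hlogγ _ (by omega), Real.rpow_neg zero_le_two, ← Nat.cast_succ, Real.rpow_natCast]
    simp only [b, ← add_assoc, one_div, inv_pow, Nat.succ_eq_add_one, pow_succ (2 : ℝ) j]
    field_simp
  · have hc := hpos (s + 1)
    have hexp : Real.exp (-b 0 - Real.log 6) = (6 * c (2 ^ (s + 1)))⁻¹ := by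
      simp only [b, add_zero, pow_zero, div_one]
      rw [← neg_add', Real.exp_neg, Real.exp_add, Real.exp_log hc, Real.exp_log (by norm_num),
        mul_comm]
    have hsq : c (2 ^ (s + 1 + 1)) ≤ c (2 ^ (s + 1)) ^ 2 := by
      rw [← Real.log_le_log_iff (hpos _) (by positivity), Real.log_pow]
      exact_mod_cast hreg.log_two_pow_succ_le (s + 1)
    have hγle : γ (s + 1) ≤ 1 / 6 := by
      rw [hγ _ (Nat.le_add_left 1 s), div_le_div_iff₀ (by positivity) (by norm_num)]
      linarith
    have hsqrt : Real.sqrt 6 / 3 ≤ Real.sqrt (1 - 2 * γ (s + 1)) := by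
      apply Real.le_sqrt_of_sq_le
      rw [div_pow, Real.sq_sqrt (by norm_num)]
      linarith
    have hrhs : Real.sqrt (1 - 2 * γ (s + 1)) / (2 * Real.exp (-b 0 - Real.log 6)) =
        Real.sqrt (1 - 2 * γ (s + 1)) * (3 * c (2 ^ (s + 1))) := by
      rw [hexp]
      field_simp
      ring
    rw [hrhs]
    nlinarith
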